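/- Let V : ℝ^d → ℝ satisfy Assumptions 1–3 and let X denote the set of all local maxima of V. If X ≠ ∅, then there exist constants R₁ > 0 and μ⁻ > 0 such that for every x with dist(x, X) ≤ R₁, the Hessian satisfies ∇²V(x) ⪯ −μ⁻·I (i.e., all eigenvalues of ∇²V(x) are at most −μ⁻). -/

import Mathlib

open MeasureTheory Real Filter Metric Set
open scoped RealInnerProductSpace ENNReal Topology

noncomputable section

abbrev Euc (n : ℕ) := EuclideanSpace ℝ (Fin n)

variable {d : ℕ}

def localMinSet (V : Euc d → ℝ) : Set (Euc d) := {x | IsLocalMin V x}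

def localMaxSet (V : Euc d → ℝ) : Set (Euc d) := {x | IsLocalMax V x}

def hessQ (V : Euc d → ℝ) (x v : Euc d) : ℝ := ⟪fderiv ℝ (gradient V) x v, v⟫

def lap (V : Euc d → ℝ) (x : Euc d) : ℝ :=
  ∑ i, hessQ V x (EuclideanSpace.basisFun (Fin d) ℝ i)

def PoincareIneq {d : ℕ} (μ : Measure (Euc d)) (ρ : ℝ) : Prop :=
  ∀ f : Euc d → ℝ, ContDiff ℝ 1 f →
    Integrable (fun x => (f x) ^ 2) μ →
    Integrable (fun x => ‖gradient f x‖ ^ 2) μ →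
    ∫ x, (f x - ∫ y, f y ∂μ) ^ 2 ∂μ ≤ (1 / ρ) * ∫ x, ‖gradient f x‖ ^ 2 ∂μ

def gibbs (V : Euc d → ℝ) (ε : ℝ) : Measure (Euc d) :=
  (ENNReal.ofReal (∫ x, exp (-V x / ε)))⁻¹ •
    volume.withDensity fun x => ENNReal.ofReal (exp (-V x / ε))

def gibbsOn (V : Euc d → ℝ) (ε : ℝ) (U : Set (Euc d)) : Measure (Euc d) :=
  (ENNReal.ofReal (∫ x in U, exp (-V x / ε)))⁻¹ •
    (volume.restrict U).withDensity fun x => ENNReal.ofReal (exp (-V x / ε))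

def uniformOn {d : ℕ} (U : Set (Euc d)) : Measure (Euc d) :=
  (volume U)⁻¹ • volume.restrict U

def Assumption1 (V : Euc d → ℝ) (ν : ℝ) (𝒩 : Set (Euc d) → Set (Euc d)) : Prop :=
  0 < ν ∧ ∀ x ∈ localMinSet V,
    IsOpen (𝒩 (connectedComponentIn (localMinSet V) x)) ∧
    connectedComponentIn (localMinSet V) x ⊆ 𝒩 (connectedComponentIn (localMinSet V) x) ∧
    ContDiffOn ℝ 3 V (𝒩 (connectedComponentIn (localMinSet V) x)) ∧
    ∀ y ∈ 𝒩 (connectedComponentIn (localMinSet V) x),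
      ν * (V y - sInf (V '' 𝒩 (connectedComponentIn (localMinSet V) x))) ≤ ‖gradient V y‖ ^ 2

def NSet (V : Euc d → ℝ) (𝒩 : Set (Euc d) → Set (Euc d)) : Set (Euc d) :=
  ⋃ x ∈ localMinSet V, 𝒩 (connectedComponentIn (localMinSet V) x)

def Assumption2 (V : Euc d → ℝ) (𝒩 : Set (Euc d) → Set (Euc d)) : Prop :=
  ∀ x ∉ NSet V 𝒩, gradient V x = 0 → ∀ v : Euc d, v ≠ 0 → hessQ V x v < 0

def Assumption3 (V : Euc d → ℝ) (R₀ ν_eb C_g : ℝ) : Prop :=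
  0 < R₀ ∧ 0 < ν_eb ∧ 0 < C_g ∧
  (∀ x : Euc d, R₀ ≤ ‖x‖ →
      ν_eb * infDist x (localMinSet V) ≤ ‖gradient V x‖ ∧ |lap V x| ≤ C_g * ‖x‖ ^ 2) ∧
  Tendsto V (cocompact (Euc d)) atTop ∧
  localMinSet V ⊆ closedBall 0 R₀

lemma grad_contDiff {d : ℕ} {V : Euc d → ℝ} (hV : ContDiff ℝ 2 V) :
    ContDiff ℝ 1 (gradient V) := by
  have h : ContDiff ℝ 1 (fderiv ℝ V) := hV.fderiv_right (by norm_num)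
  exact (InnerProductSpace.toDual ℝ (Euc d)).symm.toContinuousLinearEquiv.contDiff.comp h

lemma fderiv_eq_toDual_grad {d : ℕ} (V : Euc d → ℝ) (x : Euc d) :
    fderiv ℝ V x = InnerProductSpace.toDual ℝ (Euc d) (gradient V x) := by
  simp [gradient]

lemma grad_eq_zero_of_fderiv {d : ℕ} {V : Euc d → ℝ} {x : Euc d} (h : fderiv ℝ V x = 0) :
    gradient V x = 0 := by
  simp [gradient, h]

lemma flat_near {d : ℕ} {V : Euc d → ℝ} (hV : ContDiff ℝ 2 V) {ν m : ℝ} (hν : 0 < ν)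
    {N : Set (Euc d)} (hN : IsOpen N) (hm : ∀ x ∈ N, m ≤ V x)
    (hPL : ∀ x ∈ N, ν * (V x - m) ≤ ‖gradient V x‖ ^ 2)
    {y : Euc d} (hy : y ∈ N) (hg : gradient V y = 0) (hH : fderiv ℝ (gradient V) y = 0) :
    ∀ᶠ z in 𝓝 y, V z = m := by
  have hG := grad_contDiff hV
  have hcont : Continuous (fderiv ℝ (gradient V)) := hG.continuous_fderiv (by norm_num)
  have hev : ∀ᶠ z in 𝓝 y, z ∈ N ∧ ‖fderiv ℝ (gradient V) z‖ < ν / 8 := by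
    refine Filter.Eventually.and (hN.mem_nhds hy) ?_
    have : Tendsto (fun z => ‖fderiv ℝ (gradient V) z‖) (𝓝 y) (𝓝 0) := by
      simpa [hH] using (hcont.norm.tendsto y)
    exact this.eventually (gt_mem_nhds (by positivity))
  obtain ⟨r, hr, hball⟩ := Metric.eventually_nhds_iff_ball.1 hev
  have hlip : ∀ a ∈ ball y r, ∀ b ∈ ball y r,
      ‖gradient V b - gradient V a‖ ≤ ν / 8 * ‖b - a‖ := fun a ha b hb =>
    (convex_ball y r).norm_image_sub_le_of_norm_fderiv_le
      (fun x _ => (hG.differentiable (by norm_num)) x) (fun x hx => (hball x hx).2.le) ha hb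
  filter_upwards [ball_mem_nhds y (show 0 < r / 4 by positivity)] with x hx
  have hxr : x ∈ ball y r := ball_subset_ball (by linarith) hx
  set g := gradient V x with hgdef
  have hgx : ‖g‖ ≤ ν / 8 * ‖x - y‖ := by
    simpa [hg] using hlip y (mem_ball_self hr) x hxr
  have hxy : ‖x - y‖ < r / 4 := by simpa [dist_eq_norm] using hx
  set t : ℝ := 4 / ν with ht
  have htpos : 0 < t := by positivity
  have htg : t * ‖g‖ ≤ ‖x - y‖ / 2 := by
    calc t * ‖g‖ ≤ t * (ν / 8 * ‖x - y‖) := by gcongr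
      _ = ‖x - y‖ / 2 := by rw [ht]; field_simp; ring
  have hsub : closedBall x (t * ‖g‖) ⊆ ball y r := by
    intro w hw
    have h1 : dist w x ≤ t * ‖g‖ := hw
    have h2 : dist x y < r / 4 := hx
    have := dist_triangle w x y
    rw [mem_ball]; linarith [norm_nonneg (x - y)]
  have hz : x - t • g ∈ closedBall x (t * ‖g‖) := by
    simp [mem_closedBall, dist_eq_norm, norm_smul, abs_of_pos htpos]
  have hmv := (convex_closedBall x (t * ‖g‖)).norm_image_sub_le_of_norm_fderiv_le'
      (f := V) (φ := fderiv ℝ V x) (C := ν / 8 * (t * ‖g‖)) (𝕜 := ℝ)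
      (fun w _ => (hV.differentiable (by norm_num)) w)
      (fun w hw => by
        rw [fderiv_eq_toDual_grad, fderiv_eq_toDual_grad, ← map_sub,
          LinearIsometryEquiv.norm_map]
        refine (hlip x hxr w (hsub hw)).trans ?_
        have : ‖w - x‖ ≤ t * ‖g‖ := by simpa [dist_eq_norm] using hw
        gcongr)
      (mem_closedBall_self (by positivity)) hz
  have e1 : fderiv ℝ V x (x - t • g - x) = -(t * ‖g‖ ^ 2) := by
    rw [fderiv_eq_toDual_grad, ← hgdef, InnerProductSpace.toDual_apply_apply]
    have : x - t • g - x = -(t • g) := by abel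
    rw [this, inner_neg_right, inner_smul_right, real_inner_self_eq_norm_sq]
  have e2 : ‖x - t • g - x‖ = t * ‖g‖ := by
    simpa [norm_smul, abs_of_pos htpos]
  rw [e1, e2, Real.norm_eq_abs] at hmv
  have h3 := (abs_le.1 hmv).2
  have h4 := hm _ (hball _ (hsub hz)).1
  have h5 := hPL x (hball x hxr).1
  have h6 := hm x (hball x hxr).1
  have e3 : ν / 8 * (t * ‖g‖) * (t * ‖g‖) = 2 / ν * ‖g‖ ^ 2 := by
    rw [ht]; field_simp; ring
  rw [e3, ht] at h3
  have h7 : 2 / ν * (ν * (V x - m)) ≤ 2 / ν * ‖g‖ ^ 2 := by gcongr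
  have e4 : 2 / ν * (ν * (V x - m)) = 2 * (V x - m) := by field_simp
  have e5 : 4 / ν * ‖g‖ ^ 2 = 2 * (2 / ν * ‖g‖ ^ 2) := by ring
  rw [ht] at h4
  linarith

/-- near the (nonempty) set of local maxima, the Hessian is uniformly
negative definite: `∇²V(x) ⪯ -μ⁻ I` whenever `dist(x, X) ≤ R₁`. -/
theorem hessian_neg_near_maxima
    {d : ℕ} (V : Euc d → ℝ) (hV : ContDiff ℝ 2 V)
    (ν : ℝ) (𝒩 : Set (Euc d) → Set (Euc d))
    (h1 : Assumption1 V ν 𝒩) (h2 : Assumption2 V 𝒩)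
    (R₀ ν_eb C_g : ℝ) (h3 : Assumption3 V R₀ ν_eb C_g)
    (hX : (localMaxSet V).Nonempty) :
    ∃ R₁ > (0 : ℝ), ∃ μm > (0 : ℝ),
      ∀ x : Euc d, infDist x (localMaxSet V) ≤ R₁ →
        ∀ v : Euc d, hessQ V x v ≤ -μm * ‖v‖ ^ 2 := by
  rcases Nat.eq_zero_or_pos d with rfl | hd
  · refine ⟨1, one_pos, 1, one_pos, fun x _ v => ?_⟩
    have : v = 0 := Subsingleton.elim _ _
    simp [this, hessQ]
  haveI : Nonempty (Fin d) := ⟨⟨0, hd⟩⟩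
  haveI : Nontrivial (Euc d) := inferInstance
  obtain ⟨hν, h1⟩ := h1
  obtain ⟨hR, heb, -, hgrow, hco, hSb⟩ := h3
  have hG := grad_contDiff hV
  have hGc : Continuous (gradient V) := hG.continuous
  have hHc : Continuous (fderiv ℝ (gradient V)) := hG.continuous_fderiv (by norm_num)
  obtain ⟨x₀, hx₀⟩ := hV.continuous.exists_forall_le hco
  have hbdd : ∀ N : Set (Euc d), BddBelow (V '' N) := fun N =>
    ⟨V x₀, by rintro _ ⟨z, -, rfl⟩; exact hx₀ z⟩
  have hSne : (localMinSet V).Nonempty := ⟨x₀, Eventually.of_forall hx₀⟩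
  have hNopen : IsOpen (NSet V 𝒩) := isOpen_biUnion fun x hx => (h1 x hx).1
  -- locally flat points
  set A : Set (Euc d) := {x | ∀ᶠ z in 𝓝 x, V z = V x} with hA
  have hAgrad : ∀ x ∈ A, gradient V x = 0 := by
    intro x hx
    apply grad_eq_zero_of_fderiv
    have : V =ᶠ[𝓝 x] fun _ => V x := hx
    rw [this.fderiv_eq]; simp
  have hAopen : IsOpen A := by
    rw [isOpen_iff_mem_nhds]
    intro x hx
    have hx' : ∀ᶠ z in 𝓝 x, V z = V x := hx
    filter_upwards [eventually_eventually_nhds.2 hx', hx'] with z hz hzx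
    change ∀ᶠ w in 𝓝 z, V w = V z
    rw [hzx]; exact hz
  have hAhess : ∀ x ∈ A, fderiv ℝ (gradient V) x = 0 := by
    intro x hx
    have : gradient V =ᶠ[𝓝 x] fun _ => 0 := by
      filter_upwards [hAopen.mem_nhds hx] with z hz using hAgrad z hz
    rw [this.fderiv_eq]; simp
  have hAclosed : IsClosed A := by
    rw [← closure_subset_iff_isClosed]
    intro y hy
    have hg : gradient V y = 0 :=
      closure_minimal (t := {x | gradient V x = 0}) hAgrad
        (isClosed_eq hGc continuous_const) hy
    have hH : fderiv ℝ (gradient V) y = 0 :=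
      closure_minimal (t := {x | fderiv ℝ (gradient V) x = 0}) hAhess
        (isClosed_eq hHc continuous_const) hy
    by_cases hyN : y ∈ NSet V 𝒩
    · simp only [NSet, mem_iUnion] at hyN
      obtain ⟨s, hs, hyN⟩ := hyN
      obtain ⟨ho, -, -, hPL⟩ := h1 s hs
      have := flat_near hV hν ho (fun x hx => csInf_le (hbdd _) (mem_image_of_mem V hx)) hPL
        hyN hg hH
      change ∀ᶠ z in 𝓝 y, V z = V y
      rw [this.self_of_nhds]; exact this
    · obtain ⟨v, hv⟩ := exists_ne (0 : Euc d)
      have := h2 y hyN hg v hv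
      simp [hessQ, hH] at this
  have hAempty : A = ∅ := by
    rcases isClopen_iff.1 ⟨hAclosed, hAopen⟩ with h | h
    · exact h
    · exfalso
      have hc : ∀ x, V x = V 0 := fun x =>
        is_const_of_fderiv_eq_zero (hV.differentiable (by norm_num)) (fun z => by
          rw [fderiv_eq_toDual_grad, hAgrad z (h ▸ mem_univ z)]; simp) x 0
      obtain ⟨z, hz⟩ := (hco.eventually (eventually_gt_atTop (V 0))).exists
      exact absurd (hc z) hz.ne'
  have hXgrad : ∀ x ∈ localMaxSet V, gradient V x = 0 := fun x hx =>
    grad_eq_zero_of_fderiv (IsLocalMax.fderiv_eq_zero hx)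
  have hXN : ∀ x ∈ localMaxSet V, x ∈ (NSet V 𝒩)ᶜ := by
    intro x hx hxN
    simp only [NSet, mem_iUnion] at hxN
    obtain ⟨s, hs, hxN⟩ := hxN
    obtain ⟨ho, -, -, hPL⟩ := h1 s hs
    have hp := hPL x hxN
    rw [hXgrad x hx] at hp
    have hle : V x ≤ sInf (V '' 𝒩 (connectedComponentIn (localMinSet V) s)) := by
      by_contra hlt
      push Not at hlt
      have := mul_pos hν (sub_pos.2 hlt)
      simp at hp
      linarith
    have hxA : x ∈ A := by
      have hx' : ∀ᶠ z in 𝓝 x, V z ≤ V x := hx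
      change ∀ᶠ z in 𝓝 x, V z = V x
      filter_upwards [hx', ho.mem_nhds hxN] with z hz hzN
      exact le_antisymm hz (hle.trans (csInf_le (hbdd _) (mem_image_of_mem V hzN)))
    rw [hAempty] at hxA
    exact hxA
  have hXb : localMaxSet V ⊆ closedBall 0 R₀ := by
    intro x hx
    by_contra hlt
    have hlt : R₀ < ‖x‖ := by simpa using hlt
    have h := (hgrow x hlt.le).1
    rw [hXgrad x hx, norm_zero] at h
    have hd : ‖x‖ - R₀ ≤ infDist x (localMinSet V) := by
      refine (le_infDist hSne).2 fun s hs => ?_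
      have h5 : ‖s‖ ≤ R₀ := by simpa using hSb hs
      rw [dist_eq_norm]
      linarith [norm_sub_norm_le x s]
    have := mul_pos heb (show 0 < infDist x (localMinSet V) by linarith)
    linarith
  set K := closure (localMaxSet V) with hK
  have hKc : IsCompact K :=
    (isCompact_closedBall (0 : Euc d) R₀).of_isClosed_subset isClosed_closure
      (closure_minimal hXb isClosed_closedBall)
  have hKne : K.Nonempty := hX.closure
  have hKneg : ∀ x ∈ K, ∀ v : Euc d, v ≠ 0 → hessQ V x v < 0 := by
    intro x hx
    refine h2 x (closure_minimal hXN hNopen.isClosed_compl hx) ?_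
    exact closure_minimal (t := {x | gradient V x = 0}) hXgrad
        (isClosed_eq hGc continuous_const) hx
  have hQc : Continuous fun p : Euc d × Euc d => hessQ V p.1 p.2 := by
    unfold hessQ
    exact ((hHc.comp continuous_fst).clm_apply continuous_snd).inner continuous_snd
  have hSc : IsCompact (sphere (0 : Euc d) 1) := isCompact_sphere _ _
  have hSphne : (sphere (0 : Euc d) 1).Nonempty := NormedSpace.sphere_nonempty.2 zero_le_one
  obtain ⟨p, hp, hmax⟩ := (hKc.prod hSc).exists_isMaxOn (hKne.prod hSphne) hQc.continuousOn
  have hp0 : hessQ V p.1 p.2 < 0 := hKneg _ hp.1 _ (ne_zero_of_mem_unit_sphere ⟨p.2, hp.2⟩)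
  set μ := -(hessQ V p.1 p.2) / 2 with hμ
  have hμpos : 0 < μ := by rw [hμ]; linarith
  have hWo : IsOpen {q : Euc d × Euc d | hessQ V q.1 q.2 < -μ} :=
    isOpen_lt hQc continuous_const
  obtain ⟨U, W, hU, -, hKU, hSW, hUW⟩ := generalized_tube_lemma hKc hSc hWo (by
    intro q hq
    have : hessQ V q.1 q.2 ≤ hessQ V p.1 p.2 := hmax hq
    change hessQ V q.1 q.2 < -μ
    rw [hμ]; linarith)
  obtain ⟨δ, hδ, hδU⟩ := hKc.exists_cthickening_subset_open hU hKU
  refine ⟨δ, hδ, μ, hμpos, fun x hx v => ?_⟩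
  have hxU : x ∈ U := by
    apply hδU
    rw [hK, cthickening_closure, mem_cthickening_iff,
      ENNReal.le_ofReal_iff_toReal_le (infEDist_ne_top hX) hδ.le]
    exact hx
  by_cases hv : v = 0
  · simp [hv, hessQ]
  have hvn : 0 < ‖v‖ := norm_pos_iff.2 hv
  have hu : ‖v‖⁻¹ • v ∈ sphere (0 : Euc d) 1 := by
    simp [norm_smul, hvn.ne']
  have hlt : hessQ V x (‖v‖⁻¹ • v) < -μ := hUW (mk_mem_prod hxU (hSW hu))
  have hs : hessQ V x v = ‖v‖ ^ 2 * hessQ V x (‖v‖⁻¹ • v) := by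
    simp only [hessQ, map_smul, inner_smul_left, inner_smul_right]
    simp
    field_simp
  rw [hs]
  nlinarith [sq_nonneg ‖v‖]
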